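/- Let (A^1, A^2, r^1, r^2) be a zero-sum two-player finite normal-form game (r^2 = −r^1) with policy-independent payoffs admitting an interior Nash equilibrium, and fix base actions a^i_0 ∈ A^i. Let ξ be the shifted FoReL vector field on W = ℝ^{A^1} × ℝ^{A^2} given by ξ(w)^i(a) = Q^i_{σ(w)}(a) − Q^i_{σ(w)}(a^i_0) with σ(w) = (softmax(w^1), softmax(w^2)), and suppose φ : ℝ × W → W is a global flow of ξ (φ(0, w) = w, φ(t+s, w) = φ(t, φ(s, w)), and t ↦ φ(t, w) is differentiable with derivative ξ(φ(t, w))). Then FoReL is Poincaré recurrent: for Lebesgue-almost every w ∈ W, for every ε > 0 and every T > 0 there exists t ≥ T with ‖φ(t, w) − w‖ < ε. -/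

import Mathlib

open Finset MeasureTheory

/-- A probability vector on a finite set: nonnegative entries summing to 1. -/
def IsMixed {α : Type*} [Fintype α] (p : α → ℝ) : Prop :=
  (∀ a, 0 ≤ p a) ∧ ∑ a, p a = 1

/-- A strictly positive (interior) vector. -/
def IsInterior {α : Type*} [Fintype α] (p : α → ℝ) : Prop :=
  ∀ a, 0 < p a

/-- `softmax(y)(a) = exp(y(a)) / Σ_b exp(y(b))`. -/
noncomputable def softmax {α : Type*} [Fintype α] (y : α → ℝ) (a : α) : ℝ :=
  Real.exp (y a) / ∑ b, Real.exp (y b)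

/-- Expected payoff in a two-player finite normal-form game. -/
noncomputable def val2 {A B : Type*} [Fintype A] [Fintype B]
    (r : A → B → ℝ) (p : A → ℝ) (q : B → ℝ) : ℝ :=
  ∑ a, ∑ b, p a * q b * r a b

/-- The shifted FoReL vector field on `W = ℝ^{A} × ℝ^{B}` for a zero-sum two-player game:
`ξ(w)^i(a) = Q^i_{σ(w)}(a) − Q^i_{σ(w)}(a^i_0)` with `σ(w) = (softmax(w¹), softmax(w²))`. -/
noncomputable def xi2 {A B : Type*} [Fintype A] [Fintype B]
    (r : A → B → ℝ) (a0 : A) (b0 : B)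
    (w : (A → ℝ) × (B → ℝ)) : (A → ℝ) × (B → ℝ) :=
  (fun a => (∑ b, softmax w.2 b * r a b) - (∑ b, softmax w.2 b * r a0 b),
   fun b => (∑ a, softmax w.1 a * (- r a b)) - (∑ a, softmax w.1 a * (- r a b0)))

open Filter Topology in
theorem measurePreserving_of_tendsto {X : Type*} [MetricSpace X] [ProperSpace X]
    [MeasurableSpace X] [BorelSpace X] {μ : Measure X} [IsFiniteMeasureOnCompacts μ]
    {ψ : ℕ → X → X} {T : X → X} (hψ : ∀ n, MeasurePreserving (ψ n) μ μ)
    (hlim : ∀ x, Tendsto (fun n => ψ n x) atTop (𝓝 (T x))) {C : ℝ}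
    (hC : ∀ n x, dist (ψ n x) x ≤ C) : MeasurePreserving T μ μ := by
  have hTm : Measurable T :=
    measurable_of_tendsto_metrizable (fun n => (hψ n).measurable) (tendsto_pi_nhds.2 hlim)
  have hTC : ∀ x, dist (T x) x ≤ C := fun x =>
    le_of_tendsto ((hlim x).dist tendsto_const_nhds) (Eventually.of_forall fun n => hC n x)
  have hfin : IsFiniteMeasureOnCompacts (μ.map T) := by
    refine ⟨fun K hK => ?_⟩
    rw [Measure.map_apply hTm hK.measurableSet]
    refine (measure_mono fun x hx => ?_).trans_lt (hK.cthickening (r := C)).measure_lt_top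
    exact Metric.mem_cthickening_of_dist_le x (T x) C K hx (by rw [dist_comm]; exact hTC x)
  refine ⟨hTm, Measure.ext_of_integral_eq_on_compactlySupported fun F => ?_⟩
  have hF : Continuous fun x => F x := map_continuous F
  rw [integral_map hTm.aemeasurable hF.aestronglyMeasurable]
  obtain ⟨B, hB⟩ := hF.bounded_above_of_compact_support F.hasCompactSupport
  set K := Metric.cthickening C (tsupport F)
  have hK : IsCompact K := F.hasCompactSupport.isCompact.cthickening
  have hconv : Tendsto (fun n => ∫ x, F (ψ n x) ∂μ) atTop (𝓝 (∫ x, F (T x) ∂μ)) := by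
    refine tendsto_integral_of_dominated_convergence (K.indicator fun _ => B)
      (fun n => (hF.measurable.comp (hψ n).measurable).aestronglyMeasurable)
      ((integrable_indicator_iff hK.measurableSet).2
        (integrableOn_const hK.measure_lt_top.ne)) ?_ ?_
    · refine fun n => Eventually.of_forall fun x => ?_
      by_cases hx : x ∈ K
      · simpa [hx] using hB (ψ n x)
      · have : F (ψ n x) = 0 := by
          by_contra h
          exact hx (Metric.mem_cthickening_of_dist_le x (ψ n x) C _
            (subset_tsupport _ h) (by rw [dist_comm]; exact hC n x))
        simp [hx, this]
    · exact Eventually.of_forall fun x => (hF.tendsto _).comp (hlim x)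
  refine tendsto_nhds_unique hconv ?_
  have : ∀ n, ∫ x, F (ψ n x) ∂μ = ∫ x, F x ∂μ := fun n => by
    conv_rhs => rw [← (hψ n).map_eq]
    rw [integral_map (hψ n).measurable.aemeasurable hF.aestronglyMeasurable]
  simp [this]

theorem measurePreserving_shear {E F : Type*} [NormedAddCommGroup E] [NormedSpace ℝ E]
    [FiniteDimensional ℝ E] [MeasurableSpace E] [BorelSpace E] [NormedAddCommGroup F]
    [NormedSpace ℝ F] [FiniteDimensional ℝ F] [MeasurableSpace F] [BorelSpace F]
    (μ : Measure E) [μ.IsAddHaarMeasure] (ν : Measure F) [ν.IsAddHaarMeasure]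
    {g : E → F} (hg : Continuous g) :
    MeasurePreserving (fun w : E × F => (w.1, w.2 + g w.1)) (μ.prod ν) (μ.prod ν) := by
  refine (MeasurePreserving.id μ).skew_product (g := fun x y => y + g x) ?_ ?_
  · have := hg.comp (continuous_fst (X := E) (Y := F))
    exact (continuous_snd.add this).measurable
  · exact Filter.Eventually.of_forall fun x => map_add_right_eq_self ν (g x)

/-- One step of the symplectic Euler scheme for the field `(x, y) ↦ (f y, g x)`. -/
def symplecticEuler {E F : Type*} [AddCommGroup E] [Module ℝ E] [AddCommGroup F] [Module ℝ F]
    (f : F → E) (g : E → F) (h : ℝ) (w : E × F) : E × F :=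
  (w.1 + h • f w.2, w.2 + h • g (w.1 + h • f w.2))

section Separable

variable {E F : Type*} [NormedAddCommGroup E] [NormedSpace ℝ E] [NormedAddCommGroup F]
  [NormedSpace ℝ F] {f : F → E} {g : E → F}

theorem measurePreserving_symplecticEuler
    [FiniteDimensional ℝ E] [MeasurableSpace E] [BorelSpace E]
    [FiniteDimensional ℝ F] [MeasurableSpace F] [BorelSpace F]
    (μ : Measure E) [μ.IsAddHaarMeasure] (ν : Measure F) [ν.IsAddHaarMeasure]
    (hf : Continuous f) (hg : Continuous g) (h : ℝ) :
    MeasurePreserving (symplecticEuler f g h) (μ.prod ν) (μ.prod ν) := by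
  have h1 := measurePreserving_shear μ ν (hg.const_smul h)
  have h2 := (Measure.measurePreserving_swap (μ := ν) (ν := μ)).comp
    ((measurePreserving_shear ν μ (hf.const_smul h)).comp
      (Measure.measurePreserving_swap (μ := μ) (ν := ν)))
  exact h1.comp h2

theorem norm_symplecticEuler_sub_le {L : ℝ} (hL : 0 ≤ L)
    (hf : ∀ y y', ‖f y - f y'‖ ≤ L * ‖y - y'‖) (hg : ∀ x x', ‖g x - g x'‖ ≤ L * ‖x - x'‖)
    {h : ℝ} (hh : 0 ≤ h) (w w' : E × F) :
    ‖symplecticEuler f g h w - symplecticEuler f g h w'‖ ≤ (1 + h * L) ^ 2 * ‖w - w'‖ := by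
  have hhL : 0 ≤ h * L := mul_nonneg hh hL
  have n1 : ‖w.1 - w'.1‖ ≤ ‖w - w'‖ := norm_fst_le (w - w')
  have n2 : ‖w.2 - w'.2‖ ≤ ‖w - w'‖ := norm_snd_le (w - w')
  have e1 : ‖(w.1 + h • f w.2) - (w'.1 + h • f w'.2)‖ ≤ (1 + h * L) * ‖w - w'‖ := by
    have : (w.1 + h • f w.2) - (w'.1 + h • f w'.2) = (w.1 - w'.1) + h • (f w.2 - f w'.2) := by
      rw [smul_sub]; abel
    rw [this]
    refine (norm_add_le _ _).trans ?_
    rw [norm_smul, Real.norm_of_nonneg hh]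
    have := mul_le_mul_of_nonneg_left (hf w.2 w'.2) hh
    have := mul_le_mul_of_nonneg_left n2 hhL
    nlinarith
  have e2 : ‖(w.2 + h • g (w.1 + h • f w.2)) - (w'.2 + h • g (w'.1 + h • f w'.2))‖
      ≤ (1 + h * L) ^ 2 * ‖w - w'‖ := by
    have : (w.2 + h • g (w.1 + h • f w.2)) - (w'.2 + h • g (w'.1 + h • f w'.2))
        = (w.2 - w'.2) + h • (g (w.1 + h • f w.2) - g (w'.1 + h • f w'.2)) := by
      rw [smul_sub]; abel
    rw [this]
    refine (norm_add_le _ _).trans ?_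
    rw [norm_smul, Real.norm_of_nonneg hh]
    have a1 := mul_le_mul_of_nonneg_left (hg (w.1 + h • f w.2) (w'.1 + h • f w'.2)) hh
    have a2 := mul_le_mul_of_nonneg_left e1 hhL
    have a3 := mul_nonneg hhL (norm_nonneg (w - w'))
    nlinarith
  have e1' : (1 + h * L) * ‖w - w'‖ ≤ (1 + h * L) ^ 2 * ‖w - w'‖ :=
    mul_le_mul_of_nonneg_right (by nlinarith) (norm_nonneg _)
  exact (Prod.norm_def _).trans_le (max_le (e1.trans e1') e2)

variable {φ : ℝ → E × F → E × F}

theorem norm_symplecticEuler_sub_flow_le {L M : ℝ} (hL : 0 ≤ L)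
    (hf : ∀ y y', ‖f y - f y'‖ ≤ L * ‖y - y'‖) (hg : ∀ x x', ‖g x - g x'‖ ≤ L * ‖x - x'‖)
    (hfM : ∀ y, ‖f y‖ ≤ M) (hgM : ∀ x, ‖g x‖ ≤ M)
    (hφ0 : ∀ w, φ 0 w = w)
    (hφ : ∀ t w, HasDerivAt (fun s => φ s w) (f (φ t w).2, g (φ t w).1) t)
    {h : ℝ} (hh : 0 ≤ h) (w : E × F) :
    ‖symplecticEuler f g h w - φ h w‖ ≤ 2 * (L * M * h ^ 2) := by
  have d1 : ∀ s ∈ Set.Icc 0 h, ‖φ s w - w‖ ≤ M * s := by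
    have := norm_image_sub_le_of_norm_deriv_le_segment' (a := 0) (b := h) (C := M)
      (f := fun s => φ s w) (fun s _ => (hφ s w).hasDerivWithinAt)
      (fun s _ => (Prod.norm_def _).trans_le (max_le (hfM _) (hgM _)))
    simpa [hφ0] using this
  have hM : 0 ≤ M := (norm_nonneg _).trans (hgM w.1)
  have d2 : ‖φ h w - (w + h • (f w.2, g w.1))‖ ≤ L * M * h ^ 2 := by
    have := norm_image_sub_le_of_norm_deriv_le_segment' (a := 0) (b := h) (C := L * (M * h))
      (f := fun s => φ s w - s • (f w.2, g w.1))
      (f' := fun s => (f (φ s w).2, g (φ s w).1) - (f w.2, g w.1))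
      (fun s _ => by
        simpa only [id_eq, one_smul] using ((hφ s w).fun_sub ((hasDerivAt_id s).smul_const
          ((f w.2, g w.1) : E × F))).hasDerivWithinAt)
      (fun s hs => by
        have b : ‖φ s w - w‖ ≤ M * h := (d1 s ⟨hs.1, hs.2.le⟩).trans
          (mul_le_mul_of_nonneg_left hs.2.le hM)
        refine (Prod.norm_def _).trans_le (max_le ?_ ?_)
        · exact (hf _ _).trans (mul_le_mul_of_nonneg_left
            ((norm_snd_le (φ s w - w)).trans b) hL)
        · exact (hg _ _).trans (mul_le_mul_of_nonneg_left
            ((norm_fst_le (φ s w - w)).trans b) hL))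
      h ⟨hh, le_rfl⟩
    simp only [hφ0, zero_smul, sub_zero] at this
    calc _ = ‖φ h w - h • (f w.2, g w.1) - w‖ := by congr 1; abel
      _ ≤ _ := this
      _ = _ := by ring
  have d3 : ‖symplecticEuler f g h w - (w + h • (f w.2, g w.1))‖ ≤ L * M * h ^ 2 := by
    refine (Prod.norm_def _).trans_le (max_le ?_ ?_)
    · simp only [symplecticEuler, Prod.fst_sub, Prod.fst_add, Prod.smul_fst, sub_self, norm_zero]
      positivity
    · have : (symplecticEuler f g h w - (w + h • (f w.2, g w.1))).2
          = h • (g (w.1 + h • f w.2) - g w.1) := by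
        simp only [symplecticEuler, Prod.snd_sub, Prod.snd_add, Prod.smul_snd, smul_sub]
        abel
      rw [this, norm_smul, Real.norm_of_nonneg hh]
      have a := hg (w.1 + h • f w.2) w.1
      rw [add_sub_cancel_left, norm_smul, Real.norm_of_nonneg hh] at a
      calc h * ‖g (w.1 + h • f w.2) - g w.1‖ ≤ h * (L * (h * M)) := by
            refine mul_le_mul_of_nonneg_left (a.trans ?_) hh
            gcongr
            exact hfM _
        _ = _ := by ring
  calc _ = ‖(symplecticEuler f g h w - (w + h • (f w.2, g w.1)))
        - (φ h w - (w + h • (f w.2, g w.1)))‖ := by congr 1; abel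
    _ ≤ _ := norm_sub_le _ _
    _ ≤ _ := by linarith

theorem norm_iterate_symplecticEuler_sub_flow_le {L M : ℝ} (hL : 0 ≤ L)
    (hf : ∀ y y', ‖f y - f y'‖ ≤ L * ‖y - y'‖) (hg : ∀ x x', ‖g x - g x'‖ ≤ L * ‖x - x'‖)
    (hfM : ∀ y, ‖f y‖ ≤ M) (hgM : ∀ x, ‖g x‖ ≤ M)
    (hφ0 : ∀ w, φ 0 w = w) (hφadd : ∀ t s w, φ (t + s) w = φ t (φ s w))
    (hφ : ∀ t w, HasDerivAt (fun s => φ s w) (f (φ t w).2, g (φ t w).1) t)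
    {h : ℝ} (hh : 0 ≤ h) (n : ℕ) (w : E × F) :
    ‖(symplecticEuler f g h)^[n] w - φ (n * h) w‖
      ≤ ((1 + h * L) ^ 2) ^ n * (n * (2 * (L * M * h ^ 2))) := by
  have hM : 0 ≤ M := (norm_nonneg _).trans (hgM w.1)
  induction n with
  | zero => simp [hφ0]
  | succ n ih =>
    have hρ : 1 ≤ (1 + h * L) ^ 2 := one_le_pow₀ (by nlinarith [mul_nonneg hh hL])
    set ρ := (1 + h * L) ^ 2
    set δ := 2 * (L * M * h ^ 2)
    have hδ : 0 ≤ δ := by positivity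
    have e : φ ((n + 1 : ℕ) * h) w = φ h (φ (n * h) w) := by
      rw [← hφadd]; congr 1; push_cast; ring
    rw [Function.iterate_succ_apply', e]
    set u := (symplecticEuler f g h)^[n] w
    set v := φ (n * h) w
    have b1 := norm_symplecticEuler_sub_le hL hf hg hh u v
    have b2 := norm_symplecticEuler_sub_flow_le hL hf hg hfM hgM hφ0 hφ hh v
    have b3 : ρ * ‖u - v‖ ≤ ρ * (ρ ^ n * (n * δ)) := by gcongr
    have b4 : δ ≤ ρ ^ (n + 1) * δ := le_mul_of_one_le_left hδ (one_le_pow₀ hρ)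
    calc _ ≤ ‖symplecticEuler f g h u - symplecticEuler f g h v‖
          + ‖symplecticEuler f g h v - φ h v‖ := norm_sub_le_norm_sub_add_norm_sub _ _ _
      _ ≤ ρ * (ρ ^ n * (n * δ)) + ρ ^ (n + 1) * δ := by linarith
      _ = _ := by push_cast; ring

open Filter Topology in
/-- Liouville's theorem for the flow of a bounded Lipschitz field `(x, y) ↦ (f y, g x)`. -/
theorem measurePreserving_flow_of_separable
    [FiniteDimensional ℝ E] [MeasurableSpace E] [BorelSpace E]
    [FiniteDimensional ℝ F] [MeasurableSpace F] [BorelSpace F]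
    (μ : Measure E) [μ.IsAddHaarMeasure] (ν : Measure F) [ν.IsAddHaarMeasure]
    {L M : ℝ} (hL : 0 ≤ L)
    (hf : ∀ y y', ‖f y - f y'‖ ≤ L * ‖y - y'‖) (hg : ∀ x x', ‖g x - g x'‖ ≤ L * ‖x - x'‖)
    (hfM : ∀ y, ‖f y‖ ≤ M) (hgM : ∀ x, ‖g x‖ ≤ M)
    (hφ0 : ∀ w, φ 0 w = w) (hφadd : ∀ t s w, φ (t + s) w = φ t (φ s w))
    (hφ : ∀ t w, HasDerivAt (fun s => φ s w) (f (φ t w).2, g (φ t w).1) t)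
    {t : ℝ} (ht : 0 ≤ t) :
    MeasurePreserving (φ t) (μ.prod ν) (μ.prod ν) := by
  have hM : 0 ≤ M := (norm_nonneg _).trans (hgM 0)
  have hfc : Continuous f := (LipschitzWith.of_dist_le_mul (K := ⟨L, hL⟩) fun y y' => by
    rw [dist_eq_norm, dist_eq_norm]; exact hf y y').continuous
  have hgc : Continuous g := (LipschitzWith.of_dist_le_mul (K := ⟨L, hL⟩) fun y y' => by
    rw [dist_eq_norm, dist_eq_norm]; exact hg y y').continuous
  set D := Real.exp (2 * (t * L)) * (2 * (L * M * t ^ 2)) with hD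
  have hD0 : 0 ≤ D := by positivity
  have err : ∀ (n : ℕ) w, ‖(symplecticEuler f g (t / (n + 1)))^[n + 1] w - φ t w‖
      ≤ D * (1 / ((n : ℝ) + 1)) := by
    intro n w
    have hn : (0 : ℝ) < n + 1 := by positivity
    have := norm_iterate_symplecticEuler_sub_flow_le hL hf hg hfM hgM hφ0 hφadd hφ
      (h := t / (n + 1)) (by positivity) (n + 1) w
    have e : ((n + 1 : ℕ) : ℝ) * (t / (n + 1)) = t := by push_cast; field_simp
    rw [e] at this
    refine this.trans ?_
    have p : ((1 + t / (n + 1) * L) ^ 2) ^ (n + 1) ≤ Real.exp (2 * (t * L)) := by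
      rw [← pow_mul]
      calc _ ≤ (Real.exp (t / (n + 1) * L)) ^ (2 * (n + 1)) := by
            gcongr
            linarith [Real.add_one_le_exp (t / (n + 1) * L)]
        _ = Real.exp (2 * (t * L)) := by
            rw [← Real.exp_nat_mul]; congr 1; push_cast; field_simp
    calc _ ≤ Real.exp (2 * (t * L)) *
          (((n + 1 : ℕ) : ℝ) * (2 * (L * M * (t / (n + 1)) ^ 2))) := by gcongr
      _ = _ := by rw [hD]; push_cast; field_simp
  have disp : ∀ w, ‖φ t w - w‖ ≤ M * t := by
    intro w
    have := norm_image_sub_le_of_norm_deriv_le_segment' (a := 0) (b := t) (C := M)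
      (f := fun s => φ s w) (fun s _ => (hφ s w).hasDerivWithinAt)
      (fun s _ => (Prod.norm_def _).trans_le (max_le (hfM _) (hgM _))) t ⟨ht, le_rfl⟩
    simpa [hφ0] using this
  have : ProperSpace (E × F) := FiniteDimensional.proper ℝ _
  refine measurePreserving_of_tendsto (C := D + M * t)
    (ψ := fun n => (symplecticEuler f g (t / ((n : ℕ) + 1)))^[n + 1])
    (fun n => (measurePreserving_symplecticEuler μ ν hfc hgc _).iterate _) (fun w => ?_)
    fun n w => ?_
  · rw [tendsto_iff_norm_sub_tendsto_zero]
    refine squeeze_zero (fun _ => norm_nonneg _) (fun n => err n w) ?_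
    simpa using tendsto_one_div_add_atTop_nhds_zero_nat.const_mul D
  · rw [dist_eq_norm]
    have h1 : D * (1 / ((n : ℝ) + 1)) ≤ D := mul_le_of_le_one_right hD0 (by
      rw [div_le_one (by positivity)]; linarith [Nat.cast_nonneg (α := ℝ) n])
    exact (norm_sub_le_norm_sub_add_norm_sub _ (φ t w) _).trans
      (add_le_add ((err n w).trans h1) (disp w))

end Separable

open Filter Topology in
/-- Poincaré recurrence for a measure-preserving map of a space exhausted by invariant sets of
finite measure. -/
theorem MeasureTheory.MeasurePreserving.ae_frequently_mem_of_iUnion_eq_univ {X : Type*}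
    [TopologicalSpace X] [SecondCountableTopology X] [MeasurableSpace X] [OpensMeasurableSpace X]
    {μ : Measure X} {T : X → X} (hT : MeasurePreserving T μ μ) {K : ℕ → Set X}
    (hK : ∀ n, MeasurableSet (K n)) (hfin : ∀ n, μ (K n) < ⊤) (hinv : ∀ n, T ⁻¹' K n = K n)
    (huniv : ⋃ n, K n = Set.univ) :
    ∀ᵐ x ∂μ, ∀ s ∈ 𝓝 x, ∃ᶠ n in atTop, T^[n] x ∈ s := by
  rw [← Measure.restrict_univ (μ := μ), ← huniv, ae_restrict_iUnion_iff]
  intro n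
  have : IsFiniteMeasure (μ.restrict (K n)) := ⟨by simpa using hfin n⟩
  have h := hT.restrict_preimage (hK n)
  rw [hinv n] at h
  exact h.conservative.ae_frequently_mem_of_mem_nhds

section Softmax

variable {A : Type*} [Fintype A]

theorem sum_exp_pos [Nonempty A] (y : A → ℝ) : 0 < ∑ a, Real.exp (y a) :=
  sum_pos (fun _ _ => Real.exp_pos _) univ_nonempty

theorem isMixed_softmax [Nonempty A] (y : A → ℝ) : IsMixed (softmax y) := by
  refine ⟨fun a => div_nonneg (Real.exp_pos _).le (sum_exp_pos y).le, ?_⟩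
  simp only [softmax, ← sum_div]
  exact div_self (sum_exp_pos y).ne'

theorem IsMixed.le_one {p : A → ℝ} (hp : IsMixed p) (a : A) : p a ≤ 1 :=
  hp.2 ▸ single_le_sum (fun b _ => hp.1 b) (mem_univ a)

theorem softmax_sub_le [Nonempty A] (y y' : A → ℝ) (a : A) :
    softmax y a - softmax y' a ≤ 2 * ‖y - y'‖ := by
  set δ := ‖y - y'‖
  have hδ : ∀ b, |y b - y' b| ≤ δ := fun b => norm_le_pi_norm (y - y') b
  have h1 : Real.exp (-(2 * δ)) * softmax y a ≤ softmax y' a := by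
    have hn : Real.exp (-δ) * Real.exp (y a) ≤ Real.exp (y' a) := by
      rw [← Real.exp_add, Real.exp_le_exp]
      linarith [(abs_le.1 (hδ a)).2]
    have hd : ∑ b, Real.exp (y' b) ≤ Real.exp δ * ∑ b, Real.exp (y b) := by
      rw [mul_sum]
      refine sum_le_sum fun b _ => ?_
      rw [← Real.exp_add, Real.exp_le_exp]
      linarith [(abs_le.1 (hδ b)).1]
    calc Real.exp (-(2 * δ)) * softmax y a
        = Real.exp (-δ) * Real.exp (y a) / (Real.exp δ * ∑ b, Real.exp (y b)) := by
          have e : Real.exp (-(2 * δ)) = Real.exp (-δ) / Real.exp δ := by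
            rw [← Real.exp_sub]; congr 1; ring
          rw [softmax, e, div_mul_div_comm]
      _ ≤ softmax y' a := by
          rw [softmax]
          have := sum_exp_pos y'
          gcongr
  have h2 := Real.add_one_le_exp (-(2 * δ))
  have h3 := (isMixed_softmax y).1 a
  have h4 := (isMixed_softmax y).le_one a
  have h5 : 0 ≤ δ := norm_nonneg _
  nlinarith

theorem abs_softmax_sub_le [Nonempty A] (y y' : A → ℝ) (a : A) :
    |softmax y a - softmax y' a| ≤ 2 * ‖y - y'‖ := by
  refine abs_le.2 ⟨?_, softmax_sub_le y y' a⟩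
  have := softmax_sub_le y' y a
  rw [norm_sub_rev] at this
  linarith

/-- The advantage of each action over the base action `a0` against `softmax y`. -/
noncomputable def softmaxAdvantage {B : Type*} [Fintype B] (R : A → B → ℝ) (a0 : A)
    (y : B → ℝ) (a : A) : ℝ :=
  (∑ b, softmax y b * R a b) - (∑ b, softmax y b * R a0 b)

theorem norm_sum_mul_sub_le {B : Type*} [Fintype B] (R : A → B → ℝ) (a0 : A) {c : B → ℝ} {C : ℝ}
    (hC : 0 ≤ C) (hc : ∀ b, |c b| ≤ C) :
    ‖fun a => (∑ b, c b * R a b) - (∑ b, c b * R a0 b)‖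
      ≤ C * ∑ a, ∑ b, |R a b - R a0 b| := by
  refine (pi_norm_le_iff_of_nonneg (by positivity)).2 fun a => ?_
  rw [Real.norm_eq_abs, ← sum_sub_distrib]
  calc |∑ b, (c b * R a b - c b * R a0 b)|
      ≤ ∑ b, |c b * R a b - c b * R a0 b| := abs_sum_le_sum_abs _ _
    _ ≤ ∑ b, C * |R a b - R a0 b| := by
        refine sum_le_sum fun b _ => ?_
        rw [← mul_sub, abs_mul]
        exact mul_le_mul_of_nonneg_right (hc b) (abs_nonneg _)
    _ = C * ∑ b, |R a b - R a0 b| := (mul_sum _ _ _).symm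
    _ ≤ _ := by
        refine mul_le_mul_of_nonneg_left ?_ hC
        exact single_le_sum (f := fun a => ∑ b, |R a b - R a0 b|)
          (fun a _ => sum_nonneg fun b _ => abs_nonneg _) (mem_univ a)

theorem norm_softmaxAdvantage_le {B : Type*} [Fintype B] [Nonempty B] (R : A → B → ℝ) (a0 : A)
    (y : B → ℝ) : ‖softmaxAdvantage R a0 y‖ ≤ ∑ a, ∑ b, |R a b - R a0 b| := by
  have h := norm_sum_mul_sub_le R a0 (c := softmax y) zero_le_one fun b => by
    rw [abs_of_nonneg ((isMixed_softmax y).1 b)]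
    exact (isMixed_softmax y).le_one b
  rwa [one_mul] at h

theorem norm_softmaxAdvantage_sub_le {B : Type*} [Fintype B] [Nonempty B] (R : A → B → ℝ)
    (a0 : A) (y y' : B → ℝ) :
    ‖softmaxAdvantage R a0 y - softmaxAdvantage R a0 y'‖
      ≤ 2 * (∑ a, ∑ b, |R a b - R a0 b|) * ‖y - y'‖ := by
  have h := norm_sum_mul_sub_le R a0 (by positivity) (abs_softmax_sub_le y y')
  calc _ = ‖fun a => (∑ b, (softmax y b - softmax y' b) * R a b)
        - (∑ b, (softmax y b - softmax y' b) * R a0 b)‖ := by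
        congr 1
        ext a
        simp only [softmaxAdvantage, Pi.sub_apply, sub_mul, sum_sub_distrib]
        ring
    _ ≤ _ := h
    _ = _ := by ring

/-- The Fenchel coupling, up to an additive constant, between a mixed strategy and a logit
vector. -/
noncomputable def fenchelCoupling (s w : A → ℝ) : ℝ :=
  Real.log (∑ a, Real.exp (w a)) - ∑ a, s a * w a

theorem continuous_fenchelCoupling [Nonempty A] (s : A → ℝ) :
    Continuous (fenchelCoupling s) := by
  refine Continuous.sub (Continuous.log (by fun_prop) fun w => (sum_exp_pos w).ne') (by fun_prop)

theorem hasDerivAt_fenchelCoupling [Nonempty A] (s : A → ℝ) {u : ℝ → A → ℝ} {u' : A → ℝ} {t : ℝ}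
    (hu : HasDerivAt u u' t) :
    HasDerivAt (fun τ => fenchelCoupling s (u τ)) (∑ a, (softmax (u t) a - s a) * u' a) t := by
  have hu := hasDerivAt_pi.1 hu
  have h1 : HasDerivAt (fun τ => ∑ a, Real.exp (u τ a)) (∑ a, Real.exp (u t a) * u' a) t :=
    HasDerivAt.fun_sum fun a _ => (hu a).exp
  have h2 : HasDerivAt (fun τ => ∑ a, s a * u τ a) (∑ a, s a * u' a) t :=
    HasDerivAt.fun_sum fun a _ => (hu a).const_mul (s a)
  refine ((h1.log (sum_exp_pos _).ne').fun_sub h2).congr_deriv ?_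
  simp only [sub_mul, sum_sub_distrib, softmax, sum_div]
  congr 1
  exact sum_congr rfl fun a _ => by ring

theorem le_log_sum_exp (w : A → ℝ) (a : A) : w a ≤ Real.log (∑ b, Real.exp (w b)) := by
  have : Nonempty A := ⟨a⟩
  rw [Real.le_log_iff_exp_le (sum_exp_pos w)]
  exact single_le_sum (f := fun b => Real.exp (w b)) (fun b _ => (Real.exp_pos _).le) (mem_univ a)

theorem mul_log_sum_exp_sub_le {s : A → ℝ} (hs : IsMixed s) (w : A → ℝ) (a : A) :
    s a * (Real.log (∑ b, Real.exp (w b)) - w a) ≤ fenchelCoupling s w := by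
  have e : fenchelCoupling s w = ∑ a, s a * (Real.log (∑ b, Real.exp (w b)) - w a) := by
    simp only [mul_sub, sum_sub_distrib, ← sum_mul, hs.2, one_mul, fenchelCoupling]
  rw [e]
  exact single_le_sum (f := fun a => s a * (Real.log (∑ b, Real.exp (w b)) - w a))
    (fun b _ => mul_nonneg (hs.1 b) (sub_nonneg.2 (le_log_sum_exp w b))) (mem_univ a)

theorem fenchelCoupling_nonneg [Nonempty A] {s : A → ℝ} (hs : IsMixed s) (w : A → ℝ) :
    0 ≤ fenchelCoupling s w := by
  obtain ⟨a⟩ := ‹Nonempty A›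
  exact (mul_nonneg (hs.1 a) (sub_nonneg.2 (le_log_sum_exp w a))).trans
    (mul_log_sum_exp_sub_le hs w a)

theorem norm_le_of_fenchelCoupling_le {s : A → ℝ} (hs : IsMixed s) (hpos : IsInterior s)
    {w : A → ℝ} {a0 : A} {R : ℝ} (hH : fenchelCoupling s w ≤ R) (h0 : |w a0| ≤ R) :
    ‖w‖ ≤ R + ∑ a, R / s a := by
  have hR : 0 ≤ R := (abs_nonneg _).trans h0
  have hdiv : ∀ a, Real.log (∑ b, Real.exp (w b)) - w a ≤ ∑ a, R / s a := fun a => by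
    have h1 : Real.log (∑ b, Real.exp (w b)) - w a ≤ R / s a := by
      rw [le_div_iff₀ (hpos a), mul_comm]
      exact (mul_log_sum_exp_sub_le hs w a).trans hH
    exact h1.trans (single_le_sum (f := fun a => R / s a)
      (fun b _ => div_nonneg hR (hpos b).le) (mem_univ a))
  have hsum : 0 ≤ ∑ a, R / s a := sum_nonneg fun a _ => div_nonneg hR (hpos a).le
  refine (pi_norm_le_iff_of_nonneg (by positivity)).2 fun a => abs_le.2 ?_
  have := abs_le.1 h0
  constructor
  · linarith [hdiv a, le_log_sum_exp w a0]
  · linarith [hdiv a0, le_log_sum_exp w a]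

end Softmax

section ZeroSum

variable {A B : Type*} [Fintype A] [Fintype B]

theorem val2_eq_sum_mul (r : A → B → ℝ) (p : A → ℝ) (q : B → ℝ) :
    val2 r p q = ∑ a, p a * ∑ b, q b * r a b := by
  simp only [val2, mul_sum, mul_assoc]

theorem val2_swap (r : A → B → ℝ) (p : A → ℝ) (q : B → ℝ) :
    val2 (fun b a => r a b) q p = val2 r p q := by
  rw [val2, sum_comm]
  simp only [val2, mul_comm (q _)]

/-- Against a strategy to which an interior strategy is a best response, all actions have the
same payoff. -/
theorem payoff_eq_of_interior_bestResponse {r : A → B → ℝ} {s1 : A → ℝ} {s2 : B → ℝ}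
    (h1 : IsMixed s1) (hpos : IsInterior s1)
    (hbest : ∀ p : A → ℝ, IsMixed p → val2 r p s2 ≤ val2 r s1 s2) (a : A) :
    ∑ b, s2 b * r a b = val2 r s1 s2 := by
  classical
  have hle : ∀ a, ∑ b, s2 b * r a b ≤ val2 r s1 s2 := fun a => by
    have := hbest (Pi.single a 1) ⟨fun b => by by_cases h : b = a <;> simp [h],
      by simp⟩
    rw [val2_eq_sum_mul] at this
    simpa [Pi.single_apply] using this
  have hsum : ∑ a, s1 a * (val2 r s1 s2 - ∑ b, s2 b * r a b) = 0 := by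
    simp only [mul_sub, sum_sub_distrib, ← sum_mul, h1.2, ← val2_eq_sum_mul]
    ring
  have := (sum_eq_zero_iff_of_nonneg fun a _ =>
    mul_nonneg (h1.1 a) (sub_nonneg.2 (hle a))).1 hsum a (mem_univ a)
  linarith [(mul_eq_zero.1 this).resolve_left (hpos a).ne']

theorem sum_sub_mul_sub_const {p s u : A → ℝ} (hps : ∑ a, p a = ∑ a, s a) (c : ℝ) :
    ∑ a, (p a - s a) * (u a - c) = ∑ a, p a * u a - ∑ a, s a * u a := by
  simp only [mul_sub, sub_mul, sum_sub_distrib, ← sum_mul, hps]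
  ring

theorem sum_advantage_add_sum_advantage_eq_zero {r : A → B → ℝ} {p s1 : A → ℝ} {q s2 : B → ℝ}
    (hp : IsMixed p) (hq : IsMixed q) (h1 : IsMixed s1) (h2 : IsMixed s2) {c1 c2 : ℝ}
    (e1 : ∀ a, ∑ b, s2 b * r a b = c1) (e2 : ∀ b, ∑ a, s1 a * (- r a b) = c2) (d1 d2 : ℝ) :
    ∑ a, (p a - s1 a) * ((∑ b, q b * r a b) - d1)
      + ∑ b, (q b - s2 b) * ((∑ a, p a * (- r a b)) - d2) = 0 := by
  have swap : ∀ (x : A → ℝ) (y : B → ℝ),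
      ∑ a, x a * ∑ b, y b * r a b = - ∑ b, y b * ∑ a, x a * (- r a b) := fun x y => by
    simp only [mul_sum]
    rw [sum_comm, ← sum_neg_distrib]
    refine sum_congr rfl fun b _ => ?_
    rw [← sum_neg_distrib]
    exact sum_congr rfl fun a _ => by ring
  rw [sum_sub_mul_sub_const (hp.2.trans h1.2.symm), sum_sub_mul_sub_const (hq.2.trans h2.2.symm)]
  have k1 := swap p q
  have k2 := swap s1 q
  have k3 := swap p s2
  have k4 := swap s1 s2
  simp only [e1, e2, ← sum_mul, hp.2, hq.2, h1.2, h2.2, one_mul] at k2 k3 k4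
  linarith

end ZeroSum

/-- Poincaré recurrence of FoReL in zero-sum two-player games with an interior Nash
equilibrium: for Lebesgue-almost every starting point `w`, the flow of the shifted FoReL
vector field returns arbitrarily close to `w` at arbitrarily large times. -/
theorem forel_poincare_recurrent
    {A B : Type*} [Fintype A] [Fintype B] [Nonempty A] [Nonempty B]
    (r : A → B → ℝ)
    (hNash : ∃ (s1 : A → ℝ) (s2 : B → ℝ),
      IsMixed s1 ∧ IsInterior s1 ∧ IsMixed s2 ∧ IsInterior s2 ∧
      (∀ p : A → ℝ, IsMixed p → val2 r p s2 ≤ val2 r s1 s2) ∧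
      (∀ q : B → ℝ, IsMixed q →
        val2 (fun a b => - r a b) s1 q ≤ val2 (fun a b => - r a b) s1 s2))
    (a0 : A) (b0 : B)
    (φ : ℝ → (A → ℝ) × (B → ℝ) → (A → ℝ) × (B → ℝ))
    (hφ0 : ∀ w, φ 0 w = w)
    (hφadd : ∀ t s w, φ (t + s) w = φ t (φ s w))
    (hφderiv : ∀ t w, HasDerivAt (fun s => φ s w) (xi2 r a0 b0 (φ t w)) t) :
    ∀ᵐ w : (A → ℝ) × (B → ℝ) ∂volume,
      ∀ ε > (0 : ℝ), ∀ T > (0 : ℝ), ∃ t ≥ T, ‖φ t w - w‖ < ε := by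
  obtain ⟨s1, s2, hs1, hs1pos, hs2, hs2pos, hbest1, hbest2⟩ := hNash
  have e1 := payoff_eq_of_interior_bestResponse hs1 hs1pos hbest1
  have e2 := payoff_eq_of_interior_bestResponse (r := fun b a => - r a b) hs2 hs2pos
    fun q hq => by
      rw [val2_swap fun a b => - r a b, val2_swap fun a b => - r a b]
      exact hbest2 q hq
  have hderiv1 : ∀ t w, HasDerivAt (fun s => (φ s w).1) (xi2 r a0 b0 (φ t w)).1 t :=
    fun t w => (hφderiv t w).fst
  have hderiv2 : ∀ t w, HasDerivAt (fun s => (φ s w).2) (xi2 r a0 b0 (φ t w)).2 t :=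
    fun t w => (hφderiv t w).snd
  have const_of_deriv : ∀ {u : ℝ → ℝ}, (∀ t, HasDerivAt u 0 t) → u 1 = u 0 := fun hu =>
    is_const_of_deriv_eq_zero (fun t => (hu t).differentiableAt) (fun t => (hu t).deriv) 1 0
  let H : (A → ℝ) × (B → ℝ) → ℝ := fun w => fenchelCoupling s1 w.1 + fenchelCoupling s2 w.2
  have hHc : Continuous H := ((continuous_fenchelCoupling s1).comp continuous_fst).add
    ((continuous_fenchelCoupling s2).comp continuous_snd)
  have hH : ∀ w, H (φ 1 w) = H w := fun w => by
    have := const_of_deriv (u := fun t => H (φ t w)) fun t =>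
      ((hasDerivAt_fenchelCoupling s1 (hderiv1 t w)).fun_add
        (hasDerivAt_fenchelCoupling s2 (hderiv2 t w))).congr_deriv
        (sum_advantage_add_sum_advantage_eq_zero
          (isMixed_softmax _) (isMixed_softmax _) hs1 hs2 e1 e2 _ _)
    simpa only [hφ0] using this
  have hbase1 : ∀ w, (φ 1 w).1 a0 = w.1 a0 := fun w => by
    have := const_of_deriv (u := fun t => (φ t w).1 a0) fun t => by
      simpa [xi2] using hasDerivAt_pi.1 (hderiv1 t w) a0
    simpa only [hφ0] using this
  have hbase2 : ∀ w, (φ 1 w).2 b0 = w.2 b0 := fun w => by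
    have := const_of_deriv (u := fun t => (φ t w).2 b0) fun t => by
      simpa [xi2] using hasDerivAt_pi.1 (hderiv2 t w) b0
    simpa only [hφ0] using this
  let K : ℕ → Set ((A → ℝ) × (B → ℝ)) := fun n =>
    {w | H w ≤ n ∧ |w.1 a0| ≤ n ∧ |w.2 b0| ≤ n}
  have hKmeas : ∀ n, MeasurableSet (K n) := fun n => by
    have c1 : Continuous fun w : (A → ℝ) × (B → ℝ) => |w.1 a0| := by fun_prop
    have c2 : Continuous fun w : (A → ℝ) × (B → ℝ) => |w.2 b0| := by fun_prop
    exact ((isClosed_le hHc continuous_const).inter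
      ((isClosed_le c1 continuous_const).inter
        (isClosed_le c2 continuous_const))).measurableSet
  have hKfin : ∀ n, volume (K n) < ⊤ := fun n => by
    refine (Metric.isBounded_closedBall (x := 0)
      (r := max ((n : ℝ) + ∑ a, n / s1 a) (n + ∑ b, n / s2 b))).subset
      (fun w hw => ?_) |>.measure_lt_top
    obtain ⟨hw, hw1, hw2⟩ := hw
    have n1 := fenchelCoupling_nonneg hs1 w.1
    have n2 := fenchelCoupling_nonneg hs2 w.2
    have hw' : fenchelCoupling s1 w.1 + fenchelCoupling s2 w.2 ≤ n := hw
    rw [mem_closedBall_zero_iff, Prod.norm_def]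
    exact max_le_max (norm_le_of_fenchelCoupling_le hs1 hs1pos (by linarith) hw1)
      (norm_le_of_fenchelCoupling_le hs2 hs2pos (by linarith) hw2)
  have hKinv : ∀ n, φ 1 ⁻¹' K n = K n := fun n => by
    ext w
    simp only [K, Set.mem_preimage, Set.mem_ofPred_eq, hH, hbase1, hbase2]
  have hKuniv : ⋃ n, K n = Set.univ := by
    refine Set.eq_univ_of_forall fun w => Set.mem_iUnion.2 ?_
    obtain ⟨n, hn⟩ := exists_nat_ge (max (H w) (max |w.1 a0| |w.2 b0|))
    exact ⟨n, by simpa only [K, Set.mem_ofPred_eq, max_le_iff] using hn⟩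
  set S1 := ∑ a, ∑ b, |r a b - r a0 b|
  set S2 := ∑ b, ∑ a, |- r a b - - r a b0|
  have hS1 : 0 ≤ S1 := by positivity
  have hS2 : 0 ≤ S2 := by positivity
  have hmp : MeasurePreserving (φ 1) volume volume :=
    measurePreserving_flow_of_separable (f := softmaxAdvantage r a0)
      (g := softmaxAdvantage (fun b a => - r a b) b0) volume volume
      (L := 2 * (S1 + S2)) (M := S1 + S2) (by positivity)
      (fun y y' => (norm_softmaxAdvantage_sub_le r a0 y y').trans
        (mul_le_mul_of_nonneg_right (by linarith) (norm_nonneg _)))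
      (fun x x' => (norm_softmaxAdvantage_sub_le (fun b a => - r a b) b0 x x').trans
        (mul_le_mul_of_nonneg_right (by linarith) (norm_nonneg _)))
      (fun y => (norm_softmaxAdvantage_le r a0 y).trans (by linarith))
      (fun x => (norm_softmaxAdvantage_le (fun b a => - r a b) b0 x).trans (by linarith))
      hφ0 hφadd hφderiv zero_le_one
  have hiter : ∀ (n : ℕ) w, (φ 1)^[n] w = φ n w := fun n w => by
    induction n with
    | zero => simp [hφ0]
    | succ n ih =>
      rw [Function.iterate_succ_apply', ih, ← hφadd]
      congr 1
      push_cast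
      ring
  filter_upwards [hmp.ae_frequently_mem_of_iUnion_eq_univ hKmeas hKfin hKinv hKuniv]
    with w hw ε hε T _
  obtain ⟨n, hn, hball⟩ := Filter.frequently_atTop.1 (hw _ (Metric.ball_mem_nhds w hε)) ⌈T⌉₊
  refine ⟨n, Nat.ceil_le.1 hn, ?_⟩
  rwa [hiter, mem_ball_iff_norm] at hball
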